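/- For every m ≥ 2 and every γ with m ≤ γ ≤ 2m, there exist two quaternary linear perfect codes C₁ and C₂ of length 2^(2m), of dual type (0,2^(2m);0,m+1) and (0,2^(2m);2m,1) respectively, such that C₁ ∩ C₂ is of dual type (0,2^(2m);γ,m+1). -/

import Mathlib

open scoped BigOperators

/-- `Z2` is the ring of integers modulo 2. -/
abbrev Z2 : Type := ZMod 2

/-- `Z4` is the ring of integers modulo 4. -/
abbrev Z4 : Type := ZMod 4

/-- The ambient group `Z₂^α × Z₄^β` for additive codes. -/
abbrev Amb (α β : ℕ) : Type := (Fin α → Z2) × (Fin β → Z4)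

/-- The inner product on `Z₂^α × Z₄^β`:
`⟨u,v⟩ = 2·(Σᵢ ūᵢ·v̄ᵢ) + Σⱼ uⱼ·vⱼ ∈ Z₄`, where the bar denotes the lift `0 ↦ 0`, `1 ↦ 1`
of binary coordinates into `Z₄`. -/
def addInner {α β : ℕ} (u v : Amb α β) : Z4 :=
  2 * (∑ i, ((u.1 i).val : Z4) * ((v.1 i).val : Z4)) + ∑ j, u.2 j * v.2 j

lemma addInner_zero_left {α β : ℕ} (v : Amb α β) : addInner 0 v = 0 := by
  simp [addInner]

lemma addInner_add_left {α β : ℕ} (u u' v : Amb α β) :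
    addInner (u + u') v = addInner u v + addInner u' v := by
  have key : ∀ x x' y : Z2,
      (2 : Z4) * ((((x + x').val : ℕ) : Z4) * ((y.val : ℕ) : Z4)) =
        2 * (((x.val : ℕ) : Z4) * ((y.val : ℕ) : Z4)) +
          2 * (((x'.val : ℕ) : Z4) * ((y.val : ℕ) : Z4)) := by decide
  simp only [addInner, Prod.fst_add, Prod.snd_add, Pi.add_apply, add_mul,
    Finset.mul_sum, Finset.sum_add_distrib]
  rw [Finset.sum_congr rfl (fun i _ => key (u.1 i) (u'.1 i) (v.1 i)),
    Finset.sum_add_distrib]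
  ring

lemma addInner_neg_left {α β : ℕ} (u v : Amb α β) :
    addInner (-u) v = - addInner u v := by
  have hn : ∀ x : Z2, (-x) = x := by decide
  have key : ∀ S T : Z4, 2 * S + -T = -(2 * S + T) := by decide
  simp only [addInner, Prod.fst_neg, Prod.snd_neg, Pi.neg_apply, hn, neg_mul]
  rw [Finset.sum_neg_distrib]
  exact key _ _

/-- The additive dual `C^⊥ = {u : ⟨u,v⟩ = 0 for all v ∈ C}` of an additive code `C`. -/
def dualCode {α β : ℕ} (C : AddSubgroup (Amb α β)) : AddSubgroup (Amb α β) where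
  carrier := {u | ∀ v ∈ C, addInner u v = 0}
  zero_mem' := fun v _ => addInner_zero_left v
  add_mem' := by
    intro a b ha hb v hv
    rw [addInner_add_left, ha v hv, hb v hv, add_zero]
  neg_mem' := by
    intro a ha v hv
    rw [addInner_neg_left, ha v hv, neg_zero]

/-- An additive code `C ⊆ Z₂^α × Z₄^β` is of type `(α,β;γ,δ)` when it is isomorphic,
as an abelian group, to `Z₂^γ × Z₄^δ`; equivalently (which is how we state it),
`|C| = 2^(γ+2δ)` and the number of elements `x ∈ C` with `x + x = 0` is `2^(γ+δ)`. -/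
def isOfType {α β : ℕ} (C : AddSubgroup (Amb α β)) (γ δ : ℕ) : Prop :=
  Nat.card C = 2 ^ (γ + 2 * δ) ∧
    Nat.card {x : Amb α β // x ∈ C ∧ x + x = 0} = 2 ^ (γ + δ)

/-- An additive code `C` is of type `(α,β;γ,δ;κ)` when it is of type `(α,β;γ,δ)` and
`2^κ` is the cardinality of the image of `{x ∈ C : x + x = 0}` under the projection
onto the binary coordinates. -/
def isOfTypeK {α β : ℕ} (C : AddSubgroup (Amb α β)) (γ δ κ : ℕ) : Prop :=
  isOfType C γ δ ∧
    Nat.card ↥(Prod.fst '' {x : Amb α β | x ∈ C ∧ x + x = 0}) = 2 ^ κ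

/-- The Gray map on one quaternary coordinate:
`0 ↦ (0,0)`, `1 ↦ (0,1)`, `2 ↦ (1,1)`, `3 ↦ (1,0)`. -/
def grayPhi (y : Z4) : Z2 × Z2 :=
  if y = 0 then (0, 0) else if y = 1 then (0, 1) else if y = 2 then (1, 1) else (1, 0)

/-- The Gray map `Φ : Z₂^α × Z₄^β → Z₂^(α+2β)` (with index set `Fin α ⊕ Fin β × Fin 2`),
acting as the identity on the binary coordinates and as `grayPhi` coordinatewise on the
quaternary coordinates. -/
def grayMap {α β : ℕ} (u : Amb α β) : (Fin α ⊕ Fin β × Fin 2) → Z2 :=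
  Sum.elim (fun a => u.1 a)
    (fun b => if b.2 = 0 then (grayPhi (u.2 b.1)).1 else (grayPhi (u.2 b.1)).2)

/-- The minimum Hamming distance of a binary code `S` equals `d`. -/
def minDistEq {ι : Type} [Fintype ι] (S : Set (ι → Z2)) (d : ℕ) : Prop :=
  (∀ x ∈ S, ∀ y ∈ S, x ≠ y → d ≤ hammingDist x y) ∧
    ∃ x ∈ S, ∃ y ∈ S, x ≠ y ∧ hammingDist x y = d

/-- A quaternary linear perfect code of length `β = 2^(t-1)` (`t ≥ 3`): an additive
subgroup of `Z₄^β` whose Gray image has cardinality `2^(2β-t-1)` and minimum Hamming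
distance `4`. -/
def isQuatPerfect (t β : ℕ) (C : AddSubgroup (Amb 0 β)) : Prop :=
  3 ≤ t ∧ β = 2 ^ (t - 1) ∧
    Nat.card ↥(grayMap '' (C : Set (Amb 0 β))) = 2 ^ (2 * β - t - 1) ∧
    minDistEq (grayMap '' (C : Set (Amb 0 β))) 4

/-- An additive extended perfect code with `α ≠ 0` and binary length `α + 2β = 2^t`:
an additive subgroup of `Z₂^α × Z₄^β` with `α ≥ 1` whose Gray image has cardinality
`2^(2^t - t - 1)` and minimum Hamming distance `4`. -/
def isAddExtPerfect (t α β : ℕ) (C : AddSubgroup (Amb α β)) : Prop :=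
  1 ≤ α ∧ α + 2 * β = 2 ^ t ∧
    Nat.card ↥(grayMap '' (C : Set (Amb α β))) = 2 ^ (2 ^ t - t - 1) ∧
    minDistEq (grayMap '' (C : Set (Amb α β))) 4

/-- The embedding `Z₂ → Z₄`, `x ↦ 2x`. -/
def doubling : Z2 →+ Z4 where
  toFun x := 2 * (x.val : Z4)
  map_zero' := by decide
  map_add' := by decide

lemma doubling_injective : Function.Injective doubling := by
  unfold Function.Injective
  decide

lemma doubling_add_self (x : Z2) : doubling x + doubling x = 0 := by
  revert x; decide

lemma doubling_mul (x y : Z2) : doubling (x * y) = (x.val : Z4) * doubling y := by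
  revert x y; decide

lemma exists_doubling_eq {a : Z4} (h : a + a = 0) : ∃ b, a = doubling b := by
  revert a; decide

/-! ### Duality -/

section Duality

variable {n : ℕ}

lemma addInner_eq_sum (u v : Amb 0 n) : addInner u v = ∑ j, u.2 j * v.2 j := by
  simp [addInner]

lemma addInner_comm (u v : Amb 0 n) : addInner u v = addInner v u := by
  simp only [addInner_eq_sum, mul_comm]

/-- The bilinear pairing `addInner` as an additive map in its first argument. -/
def addInnerHom (v : Amb 0 n) : Amb 0 n →+ Z4 where
  toFun u := addInner u v
  map_zero' := addInner_zero_left v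
  map_add' u u' := addInner_add_left u u' v

lemma eq_zero_of_addInner_eq_zero {v : Amb 0 n} (h : ∀ u, addInner u v = 0) : v = 0 := by
  refine Prod.ext (Subsingleton.elim _ _) (funext fun j => ?_)
  have := h (0, Pi.single j 1)
  simpa [addInner_eq_sum, Pi.single_apply] using this

lemma exists_primitive_char : ∃ ψ : AddChar Z4 ℂ, ∀ a, ψ a = 1 → a = 0 := by
  refine ⟨ZMod.stdAddChar, fun a ha => ?_⟩
  apply ZMod.injective_stdAddChar
  simpa using ha

lemma card_mul_card_dualCode (D : AddSubgroup (Amb 0 n)) :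
    Nat.card D * Nat.card (dualCode D) = 4 ^ n := by
  classical
  obtain ⟨ψ, hψ⟩ := exists_primitive_char
  have h₁ : ∀ u : Amb 0 n, ∑ d : D, ψ (addInner u d) =
      if u ∈ dualCode D then (Fintype.card D : ℂ) else 0 := by
    intro u
    have := AddChar.sum_eq_ite (ψ.compAddMonoidHom ((addInnerHom u).comp D.subtype))
    have e : (ψ.compAddMonoidHom ((addInnerHom u).comp D.subtype) = 0) ↔ u ∈ dualCode D := by
      rw [AddChar.eq_zero_iff]
      constructor
      · intro h v hv
        rw [addInner_comm]
        exact hψ _ (h ⟨v, hv⟩)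
      · rintro h ⟨v, hv⟩
        have := h v hv
        rw [addInner_comm] at this
        change ψ (addInner v u) = 1
        rw [this, AddChar.map_zero_eq_one]
    simp only [e] at this
    rw [← this]
    exact Finset.sum_congr rfl fun d _ => by rw [addInner_comm]; rfl
  have h₂ : ∀ d : Amb 0 n, ∑ u : Amb 0 n, ψ (addInner u d) =
      if d = 0 then (Fintype.card (Amb 0 n) : ℂ) else 0 := by
    intro d
    have := AddChar.sum_eq_ite (ψ.compAddMonoidHom (addInnerHom d))
    have e : (ψ.compAddMonoidHom (addInnerHom d) = 0) ↔ d = 0 := by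
      rw [AddChar.eq_zero_iff]
      constructor
      · exact fun h => eq_zero_of_addInner_eq_zero fun u => hψ _ (h u)
      · rintro rfl u
        change ψ (addInner u 0) = 1
        rw [addInner_comm, addInner_zero_left, AddChar.map_zero_eq_one]
    simp only [e] at this
    exact this
  have key : ∑ u : Amb 0 n, ∑ d : D, ψ (addInner u d) =
      ∑ d : D, ∑ u : Amb 0 n, ψ (addInner u d) := Finset.sum_comm
  simp only [h₁, h₂, ZeroMemClass.coe_eq_zero, Finset.sum_ite_eq', Finset.mem_univ, if_true,
    ← Finset.sum_filter, Finset.sum_const, nsmul_eq_mul] at key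
  rw [← Fintype.card_subtype] at key
  have key' : Fintype.card (dualCode D) * Fintype.card D = Fintype.card (Amb 0 n) := by
    exact_mod_cast key
  rw [Nat.card_eq_fintype_card, Nat.card_eq_fintype_card, mul_comm, key']
  simp [ZMod.card]

lemma dualCode_dualCode (D : AddSubgroup (Amb 0 n)) : dualCode (dualCode D) = D := by
  have hle : D ≤ dualCode (dualCode D) := fun d hd v hv => by
    rw [addInner_comm]; exact hv d hd
  refine (AddSubgroup.eq_of_le_of_card_ge hle ?_).symm
  have h₁ := card_mul_card_dualCode D
  have h₂ := card_mul_card_dualCode (dualCode D)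
  have : 0 < Nat.card (dualCode D) := Nat.card_pos
  nlinarith

lemma dualCode_sup (D E : AddSubgroup (Amb 0 n)) :
    dualCode (D ⊔ E) = dualCode D ⊓ dualCode E := by
  ext u
  constructor
  · intro h
    exact ⟨fun v hv => h v (le_sup_left (a := D) hv), fun v hv => h v (le_sup_right (a := D) hv)⟩
  · rintro ⟨h₁, h₂⟩ v hv
    obtain ⟨x, hx, y, hy, rfl⟩ := AddSubgroup.mem_sup.1 hv
    rw [addInner_comm, addInner_add_left, addInner_comm x, addInner_comm y, h₁ x hx, h₂ y hy,
      add_zero]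

end Duality

/-! ### Minimum distance -/

section Distance

variable {n : ℕ}

/-- The Lee weight on `Z₄`. -/
def leeWeight (a : Z4) : ℕ := if a = 0 then 0 else if a = 2 then 2 else 1

lemma hammingDist_grayMap (x y : Amb 0 n) :
    hammingDist (grayMap x) (grayMap y) = ∑ j, leeWeight (x.2 j - y.2 j) := by
  have key : ∀ a b : Z4, (if (grayPhi a).1 ≠ (grayPhi b).1 then 1 else 0) +
      (if (grayPhi a).2 ≠ (grayPhi b).2 then 1 else 0) = leeWeight (a - b) := by decide
  simp only [hammingDist, Finset.card_filter, Fintype.sum_sum_type, Fintype.sum_prod_type,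
    Fin.sum_univ_two, ← key]
  simp [grayMap]

lemma grayMap_injective : Function.Injective (grayMap : Amb 0 n → _) := by
  intro x y h
  have h0 : ∑ j, leeWeight (x.2 j - y.2 j) = 0 := by
    rw [← hammingDist_grayMap, h, hammingDist_self]
  refine Prod.ext (Subsingleton.elim _ _) (funext fun j => ?_)
  have := Finset.sum_eq_zero_iff.1 h0 j (Finset.mem_univ j)
  have key : ∀ a b : Z4, leeWeight (a - b) = 0 → a = b := by decide
  exact key _ _ this

lemma even_sum_leeWeight {z : Fin n → Z4} (h : ∑ j, z j = 0) : Even (∑ j, leeWeight (z j)) := by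
  have key : ∀ a : Z4, ((leeWeight a : ℕ) : Z2) = ZMod.castHom (by decide : 2 ∣ 4) Z2 a := by decide
  rw [← ZMod.natCast_eq_zero_iff_even, Nat.cast_sum]
  simp only [key]
  rw [← map_sum, h, map_zero]

lemma four_le_sum_leeWeight {D : AddSubgroup (Amb 0 n)} (hone : ((0, 1) : Amb 0 n) ∈ D)
    (hsep : ∀ g h, (∀ d ∈ D, d.2 g = d.2 h) → g = h) {z : Amb 0 n} (hz : z ∈ dualCode D)
    (hz0 : z ≠ 0) : 4 ≤ ∑ j, leeWeight (z.2 j) := by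
  have hsum : ∑ j, z.2 j = 0 := by
    simpa [addInner_eq_sum] using hz _ hone
  have heven := even_sum_leeWeight hsum
  have hpos : ∀ a : Z4, a ≠ 0 → 1 ≤ leeWeight a := by decide
  have hle (s : Finset (Fin n)) : ∑ j ∈ s, leeWeight (z.2 j) ≤ ∑ j, leeWeight (z.2 j) :=
    Finset.sum_le_sum_of_subset (Finset.subset_univ s)
  obtain ⟨j, hj⟩ : ∃ j, z.2 j ≠ 0 := by
    by_contra! h
    exact hz0 (Prod.ext (Subsingleton.elim _ _) (funext h))
  obtain ⟨k, hkj, hk⟩ : ∃ k, k ≠ j ∧ z.2 k ≠ 0 := by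
    by_contra! h
    rw [Finset.sum_eq_single j (fun k _ hk => h k hk) (by simp)] at hsum
    exact hj hsum
  by_cases hl : ∃ l, l ≠ j ∧ l ≠ k ∧ z.2 l ≠ 0
  · obtain ⟨l, hlj, hlk, hl⟩ := hl
    have := hle {j, k, l}
    rw [Finset.sum_insert (by simp [hkj.symm, hlj.symm]), Finset.sum_pair hlk.symm] at this
    have := hpos _ hj
    have := hpos _ hk
    have := hpos _ hl
    obtain ⟨r, hr⟩ := heven
    omega
  · push Not at hl
    have hsupp (d : Fin n → Z4) : ∑ i, z.2 i * d i = z.2 j * d j + z.2 k * d k := by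
      rw [← Finset.sum_pair hkj.symm (f := fun i => z.2 i * d i)]
      refine (Finset.sum_subset (Finset.subset_univ _) fun i _ hi => ?_).symm
      simp only [Finset.mem_insert, Finset.mem_singleton, not_or] at hi
      rw [hl i hi.1 hi.2, zero_mul]
    have hjk : z.2 j + z.2 k = 0 := by
      have := hsupp 1
      simp only [Pi.one_apply, mul_one] at this
      rw [← this, hsum]
    have hlee := hle {j, k}
    rw [Finset.sum_pair hkj.symm] at hlee
    by_contra hlt
    refine hkj.symm (hsep j k fun d hd => ?_)
    have hd' := hz d hd
    rw [addInner_eq_sum, hsupp] at hd'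
    have key : ∀ a b s t : Z4, a ≠ 0 → a + b = 0 → leeWeight a + leeWeight b < 4 →
        a * s + b * t = 0 → s = t := by decide
    exact key _ _ _ _ hj hjk (by omega) hd'

lemma isQuatPerfect_dualCode {t : ℕ} (ht : 3 ≤ t) (hn : n = 2 ^ (t - 1))
    {D : AddSubgroup (Amb 0 n)} (hcard : Nat.card D = 2 ^ (t + 1))
    (hone : ((0, 1) : Amb 0 n) ∈ D) (hsep : ∀ g h, (∀ d ∈ D, d.2 g = d.2 h) → g = h)
    (hmin : ∃ g h, g ≠ h ∧ ∀ d ∈ D, d.2 g + d.2 g + (d.2 h + d.2 h) = 0) :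
    isQuatPerfect t n (dualCode D) := by
  refine ⟨ht, hn, ?_, ?_, ?_⟩
  · rw [Nat.card_image_of_injective grayMap_injective]
    have h := card_mul_card_dualCode D
    have hle : t + 1 ≤ 2 * n := by
      have : t - 1 < 2 ^ (t - 1) := Nat.lt_two_pow_self
      omega
    have h4 : 4 ^ n = 2 ^ (t + 1) * 2 ^ (2 * n - t - 1) := by
      rw [← pow_add, show (4 : ℕ) = 2 ^ 2 from rfl, ← pow_mul]
      congr 1
      omega
    rw [hcard, h4] at h
    exact Nat.eq_of_mul_eq_mul_left (by positivity) h
  · rintro _ ⟨x, hx, rfl⟩ _ ⟨y, hy, rfl⟩ hxy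
    rw [hammingDist_grayMap]
    exact four_le_sum_leeWeight hone hsep (sub_mem hx hy)
      (sub_ne_zero.2 fun h => hxy (by rw [h]))
  · obtain ⟨g, h, hgh, hD⟩ := hmin
    have hmem : ((0, Pi.single g 2 + Pi.single h 2) : Amb 0 n) ∈ dualCode D := by
      intro d hd
      simp only [addInner_eq_sum, Pi.add_apply, add_mul, Finset.sum_add_distrib,
        Pi.single_apply, ite_mul, zero_mul, Finset.sum_ite_eq', Finset.mem_univ, if_true]
      rw [← hD d hd]
      ring
    have hdist : hammingDist (grayMap ((0, Pi.single g 2 + Pi.single h 2) : Amb 0 n))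
        (grayMap 0) = 4 := by
      rw [hammingDist_grayMap]
      have hval : ∀ j, leeWeight ((Pi.single g 2 + Pi.single h 2 : Fin n → Z4) j - 0) =
          (if j = g then 2 else 0) + (if j = h then 2 else 0) := by
        intro j
        have h0 : leeWeight 0 = 0 := rfl
        have h2 : leeWeight 2 = 2 := rfl
        by_cases h₁ : j = g
        · subst h₁
          simp [hgh, h2]
        · by_cases h₂ : j = h
          · subst h₂
            simp [h₁, h2]
          · simp [h₁, h₂, h0]
      refine (Finset.sum_congr rfl fun j _ => hval j).trans ?_
      simp [Finset.sum_add_distrib]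
    refine ⟨_, ⟨_, hmem, rfl⟩, _, ⟨0, zero_mem _, rfl⟩, fun he => ?_, hdist⟩
    rw [he, hammingDist_self] at hdist
    exact absurd hdist (by decide)

end Distance

/-! ### Codes spanned by a family of quaternary words and doubled binary words -/

section Span

variable {n : ℕ} {ι κ : Type} [Fintype ι] [Fintype κ]

/-- The encoding map `(a, b) ↦ ∑ aᵢ Fᵢ + 2 ∑ bⱼ Gⱼ`. -/
def encode (F : ι → Fin n → Z4) (G : κ → Fin n → Z2) : (ι → Z4) × (κ → Z2) →+ Amb 0 n where
  toFun c := (0, fun p => ∑ i, c.1 i * F i p + doubling (∑ j, c.2 j * G j p))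
  map_zero' := by
    refine Prod.ext rfl (funext fun p => ?_)
    simp
  map_add' c c' := by
    refine Prod.ext (Subsingleton.elim _ _) (funext fun p => ?_)
    simp only [Prod.fst_add, Prod.snd_add, Pi.add_apply, add_mul, Finset.sum_add_distrib, map_add]
    abel

variable {F : ι → Fin n → Z4} {G : κ → Fin n → Z2}

lemma encode_apply (c : (ι → Z4) × (κ → Z2)) (p : Fin n) :
    (encode F G c).2 p = ∑ i, c.1 i * F i p + doubling (∑ j, c.2 j * G j p) := rfl

lemma range_encode_le {D : AddSubgroup (Amb 0 n)} (hF : ∀ i, ((0, F i) : Amb 0 n) ∈ D)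
    (hG : ∀ j, ((0, fun p => doubling (G j p)) : Amb 0 n) ∈ D) : (encode F G).range ≤ D := by
  rintro _ ⟨c, rfl⟩
  have h : encode F G c = ∑ i, (c.1 i).val • ((0, F i) : Amb 0 n) +
      ∑ j, (c.2 j).val • ((0, fun p => doubling (G j p)) : Amb 0 n) := by
    refine Prod.ext (Subsingleton.elim _ _) (funext fun p => ?_)
    rw [encode_apply]
    simp only [Prod.snd_add, Prod.snd_sum, Pi.add_apply, Finset.sum_apply,
      Prod.smul_snd, Pi.smul_apply, map_sum, doubling_mul]
    simp only [nsmul_eq_mul, ZMod.natCast_zmod_val]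
  rw [h]
  exact add_mem (sum_mem fun i _ => nsmul_mem (hF i) _) (sum_mem fun j _ => nsmul_mem (hG j) _)

lemma word_mem_range_encode (i : ι) : ((0, F i) : Amb 0 n) ∈ (encode F G).range := by
  classical
  refine ⟨(Pi.single i 1, 0), Prod.ext (Subsingleton.elim _ _) (funext fun p => ?_)⟩
  simp [encode_apply, Pi.single_apply]

lemma doubling_word_mem_range_encode (j : κ) :
    ((0, fun p => doubling (G j p)) : Amb 0 n) ∈ (encode F G).range := by
  classical
  refine ⟨(0, Pi.single j 1), Prod.ext (Subsingleton.elim _ _) (funext fun p => ?_)⟩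
  simp [encode_apply, Pi.single_apply]

lemma isOfType_range_encode (h : Function.Injective (encode F G)) :
    isOfType (encode F G).range (Fintype.card κ) (Fintype.card ι) := by
  constructor
  · rw [← Nat.card_congr (AddMonoidHom.ofInjective h).toEquiv, Nat.card_prod, Nat.card_fun,
      Nat.card_fun]
    simp only [Nat.card_eq_fintype_card, ZMod.card]
    rw [pow_add, pow_mul, mul_comm]
    norm_num
  · let f : (ι → Z2) × (κ → Z2) → {x : Amb 0 n // x ∈ (encode F G).range ∧ x + x = 0} :=
      fun c => ⟨encode F G (fun i => doubling (c.1 i), c.2), ⟨_, rfl⟩, by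
        rw [← map_add]
        convert map_zero (encode F G)
        refine Prod.ext (funext fun i => ?_) (funext fun j => ?_)
        · exact doubling_add_self _
        · exact CharTwo.add_self_eq_zero _⟩
    have hf : Function.Bijective f := by
      constructor
      · intro c c' hc
        have := h (Subtype.ext_iff.1 hc)
        simp only [Prod.mk.injEq] at this
        exact Prod.ext (funext fun i => doubling_injective (congrFun this.1 i)) this.2
      · rintro ⟨_, ⟨c, rfl⟩, hc⟩
        rw [← map_add, ← map_zero (encode F G)] at hc
        have hc := h hc
        choose b hb using fun i => exists_doubling_eq (congrFun (congrArg Prod.fst hc) i)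
        refine ⟨(b, c.2), Subtype.ext ?_⟩
        change encode F G _ = encode F G c
        congr 1
        exact Prod.ext (funext fun i => (hb i).symm) rfl
    rw [← Nat.card_congr (Equiv.ofBijective f hf), Nat.card_prod, Nat.card_fun, Nat.card_fun]
    simp only [Nat.card_eq_fintype_card, ZMod.card]
    rw [pow_add, mul_comm]

end Span

/-! ### The two codes -/

section Construction

variable {m : ℕ}

/-- A vector of `Z₄^m` given by its low and high bits. -/
abbrev Bits (m : ℕ) : Type := (Fin m → Z2) × (Fin m → Z2)

/-- The low bits of the point obtained from `p` by the involution exchanging `(0, eⱼ)` and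
`(eⱼ, eⱼ)` for each `j < k`. -/
def twist (k : ℕ) (p : Bits m) (j : Fin m) : Z2 :=
  p.1 j + if j.1 < k ∧ p.2 = Pi.single j 1 ∧ ∀ i ≠ j, p.1 i = 0 then 1 else 0

lemma single_one_injective {i j : Fin m} (h : (Pi.single i 1 : Fin m → Z2) = Pi.single j 1) :
    i = j := by
  by_contra hij
  have := congrFun h i
  simp [hij] at this

lemma twist_of_ne {k : ℕ} {p : Bits m} {i j : Fin m} (hp : p.2 = Pi.single j 1) (hij : i ≠ j) :
    twist k p i = p.1 i := by
  rw [twist, if_neg, add_zero]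
  rintro ⟨-, h, -⟩
  exact hij (single_one_injective (h.symm.trans hp))

lemma twist_of_zero {k : ℕ} {p : Bits m} (hp : p.2 = 0) (i : Fin m) : twist k p i = p.1 i := by
  rw [twist, if_neg, add_zero]
  rintro ⟨-, h, -⟩
  have := congrFun (h.symm.trans hp) i
  simp at this

lemma twist_of_le {k : ℕ} {p : Bits m} {i : Fin m} (hi : k ≤ i.1) : twist k p i = p.1 i := by
  rw [twist, if_neg, add_zero]
  rintro ⟨h, -⟩
  omega

lemma twist_twist (k : ℕ) (p : Bits m) : twist k (twist k p, p.2) = p.1 := by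
  funext j
  have h : (j.1 < k ∧ p.2 = Pi.single j 1 ∧ ∀ i ≠ j, twist k p i = 0) ↔
      (j.1 < k ∧ p.2 = Pi.single j 1 ∧ ∀ i ≠ j, p.1 i = 0) := by
    refine and_congr_right fun _ => and_congr_right fun hp => ?_
    exact forall₂_congr fun i hi => by rw [twist_of_ne hp hi]
  rw [twist]
  simp only [h]
  rw [twist, add_assoc, CharTwo.add_self_eq_zero, add_zero]

/-- The `i`-th coordinate in `Z₄` of the image of `p` under the twisting involution. -/
def quatCoord (k : ℕ) (p : Bits m) (i : Fin m) : Z4 :=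
  ((twist k p i).val : Z4) + doubling (p.2 i)

lemma quatCoord_injective (k : ℕ) : Function.Injective (quatCoord (m := m) k) := by
  have key : ∀ a b c d : Z2, (a.val : Z4) + doubling b = (c.val : Z4) + doubling d →
      a = c ∧ b = d := by decide
  intro p q h
  have h₁ : twist k p = twist k q := funext fun i => (key _ _ _ _ (congrFun h i)).1
  have h₂ : p.2 = q.2 := funext fun i => (key _ _ _ _ (congrFun h i)).2
  refine Prod.ext ?_ h₂
  rw [← twist_twist k p, ← twist_twist k q, h₁, h₂]

lemma doubling_mul_quatCoord (k : ℕ) (p : Bits m) (i : Fin m) (a : Z2) :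
    doubling a * quatCoord k p i = doubling (a * twist k p i) := by
  have key : ∀ a b c : Z2, doubling a * ((b.val : Z4) + doubling c) = doubling (a * b) := by decide
  exact key _ _ _

lemma quatCoord_add_self (k : ℕ) (p : Bits m) (i : Fin m) :
    quatCoord k p i + quatCoord k p i = doubling (twist k p i) := by
  have key : ∀ b c : Z2, ((b.val : Z4) + doubling c) + ((b.val : Z4) + doubling c) =
    doubling b := by decide
  exact key _ _

variable {n : ℕ} (e : Fin n ≃ Bits m) (k : ℕ)

/-- The all-one word and the quaternary coordinates, as words. -/
def affineWords : Option (Fin m) → Fin n → Z4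
  | none => 1
  | some i => fun p => quatCoord k (e p) i

/-- The low bits with index `j < k` and the high bits, as words. -/
def bitWords : {j : Fin m // j.1 < k} ⊕ Fin m → Fin n → Z2
  | .inl j => fun p => (e p).1 j
  | .inr j => fun p => (e p).2 j

/-- All the bits, as words. -/
def allBitWords : Fin m ⊕ Fin m → Fin n → Z2
  | .inl j => fun p => (e p).1 j
  | .inr j => fun p => (e p).2 j

variable {e k}

lemma affine_eq_zero (hm : 2 ≤ m) {c : Z2} {a b b' : Fin m → Z2}
    (hb : ∀ j : Fin m, k ≤ j.1 → b j = 0)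
    (h : ∀ p : Bits m, c + ∑ i, a i * twist k p i + (∑ j, b j * p.1 j + ∑ j, b' j * p.2 j) = 0) :
    c = 0 ∧ a = 0 ∧ b = 0 ∧ b' = 0 := by
  have hc : c = 0 := by
    have := h 0
    simpa [twist_of_zero] using this
  subst hc
  have hab (j : Fin m) : a j + b j = 0 := by
    have := h (Pi.single j 1, 0)
    simpa [twist_of_zero, Pi.single_apply] using this
  have hb' (j : Fin m) : b' j = 0 := by
    have : Nontrivial (Fin m) := Fin.nontrivial_iff_two_le.2 hm
    obtain ⟨i, hi⟩ := exists_ne j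
    have h₁ := h (Pi.single i 1, Pi.single j 1)
    have h₂ : twist k (Pi.single i 1, Pi.single j 1) = (Pi.single i 1 : Fin m → Z2) := by
      funext l
      rw [twist, if_neg, add_zero]
      rintro ⟨-, hl, hl'⟩
      have hlj := single_one_injective hl
      have := hl' i (by rw [← hlj]; exact hi)
      simp at this
    rw [h₂] at h₁
    simp only [Pi.single_apply, mul_ite, mul_one, mul_zero, Finset.sum_ite_eq', Finset.mem_univ,
      if_true, zero_add] at h₁
    rwa [← add_assoc, hab, zero_add] at h₁
  have ha (j : Fin m) : a j = 0 := by
    by_cases hj : j.1 < k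
    · have h₁ := h (0, Pi.single j 1)
      have h₂ : twist k (0, Pi.single j 1) = (Pi.single j 1 : Fin m → Z2) := by
        funext l
        by_cases hl : l = j
        · subst hl
          simp [twist, hj]
        · rw [twist_of_ne rfl hl]
          simp [hl]
      rw [h₂] at h₁
      simpa [Pi.single_apply, hb'] using h₁
    · simpa [hb j (by omega)] using hab j
  refine ⟨rfl, funext ha, funext fun j => ?_, funext hb'⟩
  simpa [ha] using hab j

lemma sum_option_affineWords (a : Option (Fin m) → Z4) (p : Fin n) :
    ∑ i, a i * affineWords e k i p = a none + ∑ i, a (some i) * quatCoord k (e p) i := by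
  simp [Fintype.sum_option, affineWords]

lemma add_self_eq_zero_of_forall {c : Z4} {a : Fin m → Z4} {f : Bits m → Z2}
    (h : ∀ p : Bits m, c + ∑ i, a i * quatCoord k p i + doubling (f p) = 0) :
    c + c = 0 ∧ ∀ i, a i + a i = 0 := by
  have h₂ (p : Bits m) : c + c + ∑ i, a i * doubling (twist k p i) = 0 := by
    have h₁ := h p
    have : (c + ∑ i, a i * quatCoord k p i + doubling (f p)) +
        (c + ∑ i, a i * quatCoord k p i + doubling (f p)) = 0 := by rw [h₁, add_zero]
    rw [← this]
    simp only [← quatCoord_add_self, mul_add, Finset.sum_add_distrib]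
    linear_combination -doubling_add_self (f p)
  have hc : c + c = 0 := by
    simpa [twist_of_zero] using h₂ 0
  refine ⟨hc, fun i => ?_⟩
  have h₃ := h₂ (Pi.single i 1, 0)
  simp only [twist_of_zero, Pi.single_apply, hc, zero_add, apply_ite doubling, map_zero, mul_ite,
    mul_zero, Finset.sum_ite_eq', Finset.mem_univ, if_true] at h₃
  rw [← h₃, show doubling 1 = 2 from rfl, mul_two]

lemma encode_injective_of_twist (hm : 2 ≤ m) :
    Function.Injective (encode (affineWords e k) (bitWords e k)) := by
  classical
  rw [injective_iff_map_eq_zero]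
  rintro ⟨a, b⟩ hab
  have h (p : Bits m) : a none + ∑ i, a (some i) * quatCoord k p i +
      doubling (∑ j, b (.inl j) * p.1 j + ∑ j, b (.inr j) * p.2 j) = 0 := by
    have := congrFun (congrArg Prod.snd hab) (e.symm p)
    rw [encode_apply, sum_option_affineWords] at this
    simpa [Fintype.sum_sum_type, bitWords] using this
  obtain ⟨hc, ha⟩ := add_self_eq_zero_of_forall h
  obtain ⟨c, hc⟩ := exists_doubling_eq hc
  choose a' ha' using fun i => exists_doubling_eq (ha i)
  let b₁ : Fin m → Z2 := fun j => if hj : j.1 < k then b (.inl ⟨j, hj⟩) else 0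
  have hb₁ (x : Fin m → Z2) : ∑ j, b₁ j * x j = ∑ j : {j : Fin m // j.1 < k}, b (.inl j) * x j := by
    rw [← Finset.sum_filter_add_sum_filter_not _ (fun j : Fin m => j.1 < k),
      Finset.sum_subtype _ (p := fun j : Fin m => j.1 < k) (by simp),
      Finset.sum_eq_zero (s := Finset.univ.filter fun j : Fin m => ¬ j.1 < k), add_zero]
    · exact Finset.sum_congr rfl fun j _ => by simp [b₁, j.2]
    · intro j hj
      simp [b₁, (Finset.mem_filter.1 hj).2]
  obtain ⟨h₁, h₂, h₃, h₄⟩ := affine_eq_zero (k := k) hm (c := c) (a := a') (b := b₁)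
    (b' := fun j => b (.inr j)) (fun j hj => dif_neg (by omega)) fun p => by
      apply doubling_injective
      rw [map_zero, ← h p, hb₁, map_add, map_add, map_sum, hc]
      simp only [ha', doubling_mul_quatCoord]
  refine Prod.ext (funext fun i => ?_) (funext fun j => ?_)
  · cases i with
    | none => simp [hc, h₁]
    | some i => simp [ha', h₂]
  · rcases j with j | j
    · have := congrFun h₃ j.1
      simpa [b₁, j.2] using this
    · exact congrFun h₄ j

lemma encode_injective_affine (hm : 2 ≤ m) :
    Function.Injective (encode (affineWords e k) (PEmpty.elim : PEmpty → Fin n → Z2)) := by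
  rw [injective_iff_map_eq_zero]
  rintro ⟨a, b⟩ hab
  have h := (injective_iff_map_eq_zero _).1 (encode_injective_of_twist (e := e) (k := k) hm) (a, 0)
    (by rw [← hab]
        refine Prod.ext rfl (funext fun p => ?_)
        simp [encode_apply])
  exact Prod.ext (Prod.ext_iff.1 h).1 (Subsingleton.elim _ _)

lemma encode_injective_bits :
    Function.Injective (encode (fun _ : Unit => (1 : Fin n → Z4)) (allBitWords e)) := by
  rw [injective_iff_map_eq_zero]
  rintro ⟨a, b⟩ hab
  have h (p : Bits m) : a () +
      doubling (∑ j, b (.inl j) * p.1 j + ∑ j, b (.inr j) * p.2 j) = 0 := by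
    have := congrFun (congrArg Prod.snd hab) (e.symm p)
    rw [encode_apply] at this
    simpa [Fintype.sum_sum_type, allBitWords] using this
  have ha : a () = 0 := by simpa using h 0
  have h' (p : Bits m) : ∑ j, b (.inl j) * p.1 j + ∑ j, b (.inr j) * p.2 j = 0 := by
    apply doubling_injective
    simpa [ha] using h p
  refine Prod.ext (funext fun _ => ha) (funext fun j => ?_)
  rcases j with j | j
  · simpa [Pi.single_apply] using h' (Pi.single j 1, 0)
  · simpa [Pi.single_apply] using h' (0, Pi.single j 1)

lemma sup_range_encode :
    (encode (affineWords e k) (PEmpty.elim : PEmpty → Fin n → Z2)).range ⊔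
      (encode (fun _ : Unit => (1 : Fin n → Z4)) (allBitWords e)).range =
      (encode (affineWords e k) (bitWords e k)).range := by
  apply le_antisymm
  · refine sup_le (range_encode_le word_mem_range_encode (fun j => j.elim)) (range_encode_le
      (fun _ => word_mem_range_encode (F := affineWords e k) none) ?_)
    rintro (j | j)
    · by_cases hj : j.1 < k
      · exact doubling_word_mem_range_encode (G := bitWords e k) (.inl ⟨j, hj⟩)
      · have h := word_mem_range_encode (F := affineWords e k) (G := bitWords e k) (some j)
        convert add_mem h h using 1
        refine Prod.ext rfl (funext fun p => ?_)
        have := quatCoord_add_self k (e p) j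
        rw [twist_of_le (by omega)] at this
        exact this.symm
    · exact doubling_word_mem_range_encode (G := bitWords e k) (.inr j)
  · refine range_encode_le (fun i => le_sup_left (α := AddSubgroup _) (word_mem_range_encode i)) ?_
    rintro (j | j)
    · exact le_sup_right (α := AddSubgroup _)
        (doubling_word_mem_range_encode (G := allBitWords e) (.inl j.1))
    · exact le_sup_right (α := AddSubgroup _)
        (doubling_word_mem_range_encode (G := allBitWords e) (.inr j))

lemma isQuatPerfect_affine (hm : 2 ≤ m) (hn : n = 2 ^ (2 * m)) :
    isQuatPerfect (2 * m + 1) n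
      (dualCode (encode (affineWords e k) (PEmpty.elim : PEmpty → Fin n → Z2)).range) := by
  refine isQuatPerfect_dualCode (by omega) (by simpa using hn) ?_
    (word_mem_range_encode (F := affineWords e k) none) (fun g h hgh => ?_) ?_
  · rw [(isOfType_range_encode (encode_injective_affine hm)).1]
    simp only [Fintype.card_pempty, Fintype.card_option, Fintype.card_fin]
    congr 1
    omega
  · apply e.injective
    apply quatCoord_injective k
    funext i
    exact hgh _ (word_mem_range_encode (F := affineWords e k) (some i))
  · refine ⟨e.symm (0, 0), e.symm (0, 1), fun h => ?_, ?_⟩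
    · have := congrFun (congrArg Prod.snd (e.symm.injective h)) ⟨0, by omega⟩
      simp at this
    · rintro _ ⟨c, rfl⟩
      have h₀ : twist k (0, 0) = (0 : Fin m → Z2) := funext (twist_of_zero rfl)
      have h₁ : twist k (0, 1) = (0 : Fin m → Z2) := by
        have : Nontrivial (Fin m) := Fin.nontrivial_iff_two_le.2 hm
        funext j
        rw [twist, if_neg]
        · rfl
        · rintro ⟨-, h, -⟩
          obtain ⟨i, hi⟩ := exists_ne j
          have := congrFun h i
          simp [hi] at this
      have hdbl (p : Bits m) (hp : twist k p = 0) : ∑ i, c.1 (some i) * quatCoord k p i +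
          ∑ i, c.1 (some i) * quatCoord k p i = 0 := by
        rw [← Finset.sum_add_distrib]
        refine Finset.sum_eq_zero fun i _ => ?_
        rw [← mul_add, quatCoord_add_self, hp, Pi.zero_apply, map_zero, mul_zero]
      have h4 : ∀ a : Z4, a + a + (a + a) = 0 := by decide
      simp only [encode_apply, sum_option_affineWords, Equiv.apply_symm_apply, Finset.univ_eq_empty,
        Finset.sum_empty, map_zero, add_zero]
      linear_combination h4 (c.1 none) + hdbl _ h₀ + hdbl _ h₁

lemma isQuatPerfect_bits (hm : 2 ≤ m) (hn : n = 2 ^ (2 * m)) :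
    isQuatPerfect (2 * m + 1) n
      (dualCode (encode (fun _ : Unit => (1 : Fin n → Z4)) (allBitWords e)).range) := by
  refine isQuatPerfect_dualCode (by omega) (by simpa using hn) ?_
    (word_mem_range_encode (F := fun _ : Unit => (1 : Fin n → Z4)) ()) (fun g h hgh => ?_) ?_
  · rw [(isOfType_range_encode encode_injective_bits).1]
    simp only [Fintype.card_unit, Fintype.card_sum, Fintype.card_fin]
    congr 1
    omega
  · apply e.injective
    refine Prod.ext (funext fun j => doubling_injective ?_)
      (funext fun j => doubling_injective ?_)
    · exact hgh _ (doubling_word_mem_range_encode (G := allBitWords e) (.inl j))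
    · exact hgh _ (doubling_word_mem_range_encode (G := allBitWords e) (.inr j))
  · have : 1 < n := by
      rw [hn]; exact Nat.one_lt_two_pow (by omega)
    refine ⟨⟨0, by omega⟩, ⟨1, this⟩, by simp, ?_⟩
    rintro _ ⟨c, rfl⟩
    have key : ∀ (x : Z4) (y z : Z2), x + doubling y + (x + doubling y) +
        (x + doubling z + (x + doubling z)) = 0 := by decide
    simp only [encode_apply]
    exact key _ _ _

end Construction

/-- for `m ≥ 2` and `m ≤ γ ≤ 2m`, two quaternary linear perfect codes of
length `2^(2m)` with given dual types whose intersection is of dual type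
`(0,2^(2m);γ,m+1)` exist. -/
theorem stmt10 {m γ : ℕ} (hm : 2 ≤ m) (hγ₁ : m ≤ γ) (hγ₂ : γ ≤ 2 * m) :
    ∃ C₁ C₂ : AddSubgroup (Amb 0 (2 ^ (2 * m))),
      isQuatPerfect (2 * m + 1) (2 ^ (2 * m)) C₁ ∧
      isQuatPerfect (2 * m + 1) (2 ^ (2 * m)) C₂ ∧
      isOfType (dualCode C₁) 0 (m + 1) ∧ isOfType (dualCode C₂) (2 * m) 1 ∧
      isOfType (dualCode (C₁ ⊓ C₂)) γ (m + 1) := by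
  have e : Fin (2 ^ (2 * m)) ≃ Bits m := by
    refine Fintype.equivOfCardEq ?_
    simp [ZMod.card, ← pow_add, two_mul]
  have hk : Fintype.card {j : Fin m // j.1 < γ - m} = γ - m := by
    rw [Fintype.card_subtype, Fin.card_filter_val_lt]
    omega
  refine ⟨_, _, isQuatPerfect_affine (e := e) (k := γ - m) hm rfl,
    isQuatPerfect_bits (e := e) hm rfl, ?_, ?_, ?_⟩
  · rw [dualCode_dualCode]
    simpa using isOfType_range_encode (encode_injective_affine (e := e) (k := γ - m) hm)
  · rw [dualCode_dualCode]
    simpa [two_mul] using isOfType_range_encode (encode_injective_bits (e := e))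
  · rw [← dualCode_sup, dualCode_dualCode, sup_range_encode]
    have h := isOfType_range_encode (encode_injective_of_twist (e := e) (k := γ - m) hm)
    rw [Fintype.card_sum, hk, Fintype.card_option, Fintype.card_fin, Nat.sub_add_cancel hγ₁] at h
    exact h
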